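/- arXiv:2110.07155 — 2 statements merged into one kernel-verified Lean document; each statement's English description precedes it below -/
import Mathlib

section
/- The specialized partition function f(1ₙ) = αₙ · F_id(x₁,…,xₙ, qx₁,…,qxₙ) is a symmetric function of x₁,…,xₙ: for every permutation σ ∈ Sₙ, f(1ₙ)(x_{σ(1)},…,x_{σ(n)}) = f(1ₙ)(x₁,…,xₙ). -/
open Finset

noncomputable section

/-- The ambient field: fraction field of polynomials over `ℚ` in countably many
indeterminates; `qq`, `tt` and the `xx i`, `yy i` below are algebraically independent
indeterminates, so identities among them are identities of rational functions
in `q`, `t` and the `x i` (and `y i`) over `ℚ`. -/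
abbrev F : Type := FractionRing (MvPolynomial ℕ ℚ)

def gen (i : ℕ) : F := algebraMap (MvPolynomial ℕ ℚ) F (MvPolynomial.X i)

/-- the indeterminate `q` -/
def qq : F := gen 0
/-- the indeterminate `t` -/
def tt : F := gen 1
/-- the indeterminate `x_{i+1}` (0-based) -/
def xx (i : ℕ) : F := gen (2 + 2 * i)
/-- the indeterminate `y_{i+1}` (0-based) -/
def yy (i : ℕ) : F := gen (3 + 2 * i)

/-- labelings of the `2n` edge positions by values in `{1,…,n+1}` (0-based). -/
abbrev Lab (n : ℕ) := Fin (2 * n) → Fin (n + 1)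

abbrev Mat (n : ℕ) := Matrix (Lab n) (Lab n) F

/-- the structure constant `c((a,b),(a',b'))` of the generator `T`. -/
def Tcoeff (n : ℕ) (a b a' b' : Fin (n + 1)) : F :=
  if a' = a ∧ b' = b ∧ b < a then tt - 1
  else if a' = b ∧ b' = a ∧ a < b then 1
  else if a' = b ∧ b' = a ∧ b ≤ a then tt
  else 0

/-- the (standard, column-convention) matrix of `T_i` acting at 0-based positions `p, p+1`:
the `(κ, κ')` entry is the coefficient of `e_κ` in `T e_{κ'}`. -/
def Tmat (n : ℕ) (p : ℕ) : Mat n :=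
  Matrix.of fun κ κ' =>
    if h : p + 1 < 2 * n then
      if ∀ j : Fin (2 * n), (j : ℕ) ≠ p → (j : ℕ) ≠ p + 1 → κ j = κ' j then
        Tcoeff n (κ' ⟨p, by omega⟩) (κ' ⟨p + 1, h⟩) (κ ⟨p, by omega⟩) (κ ⟨p + 1, h⟩)
      else 0
    else 0

/-- `Ř_i(u) = (1−t)·Id + (1−u)·T_i` at 0-based position `p`. -/
def Rmat (n : ℕ) (p : ℕ) (u : F) : Mat n := (1 - tt) • (1 : Mat n) + (1 - u) • Tmat n p

/-- the ordered product `Z = ∏_{j=1}^{n} (Ř_{n+j−1}(xₙ/y_j)·Ř_{n+j−2}(x_{n−1}/y_j)⋯Ř_j(x₁/y_j))`,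
columns `j = 1,…,n` multiplied left to right (matrices in the standard convention, so that
an operator product written left to right is the corresponding matrix product). -/
def Zmat (n : ℕ) (x y : ℕ → F) : Mat n :=
  ((List.range n).map fun j =>
    ((List.range n).map fun r => Rmat n (j + (n - 1 - r)) (x (n - 1 - r) / y j)).prod).prod

/-- the labeling `(ω̄(v(1)),…,ω̄(v(2n)))` of `|v⟩` for `v ∈ Sₙ ⊂ S_{2n}`. -/
def labP (n : ℕ) (v : Equiv.Perm (Fin n)) : Lab n := fun p =>
  if h : (p : ℕ) < n then Fin.castSucc (v ⟨p, h⟩) else Fin.last n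

/-- the number of inversions (Coxeter length) of a permutation. -/
def ell {n : ℕ} (v : Equiv.Perm (Fin n)) : ℕ :=
  ((Finset.univ : Finset (Fin n × Fin n)).filter fun p => p.1 < p.2 ∧ v p.2 < v p.1).card

/-- `αₙ = (q/t)^{n(n−1)/2} (1−t)^{−n}`. -/
def alpha (n : ℕ) : F := (qq / tt) ^ (n * (n - 1) / 2) * (1 - tt)⁻¹ ^ n

/-- the matrix element `F_v = ⟨1| Z |v⟩`. -/
def Fv (n : ℕ) (x y : ℕ → F) (v : Equiv.Perm (Fin n)) : F :=
  Zmat n x y (labP n 1) (labP n v)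

/-- `f(1ₙ) = αₙ · F_id(x₁,…,xₙ, qx₁,…,qxₙ)` as a function of the values `x`. -/
def pf1 (n : ℕ) (x : ℕ → F) : F :=
  alpha n * Zmat n x (fun i => qq * x i) (labP n 1) (labP n 1)

/-- The labeling with the entries at positions `p` and `p + 1` exchanged. -/
def posSwap {n : ℕ} (p : ℕ) (h : p + 1 < 2 * n) (κ : Lab n) : Lab n :=
  κ ∘ Equiv.swap ⟨p, by omega⟩ ⟨p + 1, h⟩

section Positions

variable {n : ℕ}

lemma posSwap_left {p : ℕ} (h : p + 1 < 2 * n) (κ : Lab n) (h' : p < 2 * n) :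
    posSwap p h κ ⟨p, h'⟩ = κ ⟨p + 1, h⟩ := by
  simp [posSwap]

lemma posSwap_right {p : ℕ} (h : p + 1 < 2 * n) (κ : Lab n) :
    posSwap p h κ ⟨p + 1, h⟩ = κ ⟨p, by omega⟩ := by
  simp [posSwap]

lemma posSwap_of_ne {p : ℕ} (h : p + 1 < 2 * n) (κ : Lab n) {j : ℕ} (hj : j < 2 * n)
    (h₁ : j ≠ p) (h₂ : j ≠ p + 1) : posSwap p h κ ⟨j, hj⟩ = κ ⟨j, hj⟩ := by
  simp [posSwap, Equiv.swap_apply_of_ne_of_ne, h₁, h₂]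

lemma posSwap_posSwap {p : ℕ} (h : p + 1 < 2 * n) (κ : Lab n) :
    posSwap p h (posSwap p h κ) = κ := by
  funext j
  simp [posSwap]

lemma posSwap_comm {p q : ℕ} (hp : p + 1 < 2 * n) (hq : q + 1 < 2 * n) (hpq : p + 2 ≤ q)
    (κ : Lab n) : posSwap p hp (posSwap q hq κ) = posSwap q hq (posSwap p hp κ) := by
  funext j
  simp only [posSwap, Function.comp_apply]
  congr 1
  ext
  simp only [Equiv.swap_apply_def, Fin.ext_iff, apply_ite Fin.val]
  split_ifs <;> omega

lemma posSwap_braid {p : ℕ} (h : p + 1 < 2 * n) (h' : p + 1 + 1 < 2 * n) (κ : Lab n) :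
    posSwap p h (posSwap (p + 1) h' (posSwap p h κ)) =
      posSwap (p + 1) h' (posSwap p h (posSwap (p + 1) h' κ)) := by
  funext j
  simp only [posSwap, Function.comp_apply]
  congr 1
  ext
  simp only [Equiv.swap_apply_def, Fin.ext_iff, apply_ite Fin.val]
  split_ifs <;> omega

lemma posSwap_eq_self {p : ℕ} (h : p + 1 < 2 * n) (κ : Lab n)
    (he : κ ⟨p, by omega⟩ = κ ⟨p + 1, h⟩) : posSwap p h κ = κ := by
  funext j
  by_cases h₁ : (j : ℕ) = p
  · obtain ⟨j, hj⟩ := j; subst h₁; rw [posSwap_left, he]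
  by_cases h₂ : (j : ℕ) = p + 1
  · obtain ⟨j, hj⟩ := j; subst h₂; rw [posSwap_right, he]
  exact posSwap_of_ne h κ j.2 h₁ h₂

lemma eq_posSwap_iff {p : ℕ} (h : p + 1 < 2 * n) (κ κ' : Lab n) :
    κ' = posSwap p h κ ↔ (∀ j : Fin (2 * n), (j : ℕ) ≠ p → (j : ℕ) ≠ p + 1 → κ j = κ' j) ∧
      κ' ⟨p, by omega⟩ = κ ⟨p + 1, h⟩ ∧ κ' ⟨p + 1, h⟩ = κ ⟨p, by omega⟩ := by
  constructor
  · rintro rfl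
    exact ⟨fun j h₁ h₂ => (posSwap_of_ne h κ j.2 h₁ h₂).symm, posSwap_left h κ _,
      posSwap_right h κ⟩
  · rintro ⟨h₀, hl, hr⟩
    funext j
    by_cases h₁ : (j : ℕ) = p
    · obtain ⟨j, hj⟩ := j; subst h₁; rw [posSwap_left, hl]
    by_cases h₂ : (j : ℕ) = p + 1
    · obtain ⟨j, hj⟩ := j; subst h₂; rw [posSwap_right, hr]
    · rw [posSwap_of_ne h κ j.2 h₁ h₂, h₀ j h₁ h₂]

lemma eq_iff_of_pair {p : ℕ} (h : p + 1 < 2 * n) (κ κ' : Lab n) :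
    κ' = κ ↔ (∀ j : Fin (2 * n), (j : ℕ) ≠ p → (j : ℕ) ≠ p + 1 → κ j = κ' j) ∧
      κ' ⟨p, by omega⟩ = κ ⟨p, by omega⟩ ∧ κ' ⟨p + 1, h⟩ = κ ⟨p + 1, h⟩ := by
  constructor
  · rintro rfl
    exact ⟨fun _ _ _ => rfl, rfl, rfl⟩
  · rintro ⟨h₀, hl, hr⟩
    funext j
    by_cases h₁ : (j : ℕ) = p
    · obtain ⟨j, hj⟩ := j; subst h₁; exact hl
    by_cases h₂ : (j : ℕ) = p + 1
    · obtain ⟨j, hj⟩ := j; subst h₂; exact hr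
    · exact (h₀ j h₁ h₂).symm

open scoped Classical in
/-- Diagonal coefficient of the Hecke generator on a pair of labels. -/
def heckeDiag (P : Prop) : F := if P then tt - 1 else 0

open scoped Classical in
/-- Off-diagonal coefficient of the Hecke generator on a pair of labels. -/
def heckeOff (P : Prop) : F := if P then 1 else tt

lemma Tmat_apply {p : ℕ} (h : p + 1 < 2 * n) (κ κ' : Lab n) :
    Tmat n p κ κ' =
      (if κ' = κ then heckeDiag (κ ⟨p + 1, h⟩ < κ ⟨p, by omega⟩) else 0) +
      (if κ' = posSwap p h κ then heckeOff (κ ⟨p + 1, h⟩ < κ ⟨p, by omega⟩) else 0) := by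
  simp only [eq_posSwap_iff h κ κ', eq_iff_of_pair h κ κ', Tmat, Matrix.of_apply, dif_pos h,
    Tcoeff, heckeDiag, heckeOff]
  by_cases h₀ : ∀ j : Fin (2 * n), (j : ℕ) ≠ p → (j : ℕ) ≠ p + 1 → κ j = κ' j
  · simp only [eq_true h₀, true_and, if_true]
    generalize κ ⟨p, _⟩ = a
    generalize κ ⟨p + 1, h⟩ = b
    generalize κ' ⟨p, _⟩ = a'
    generalize κ' ⟨p + 1, h⟩ = b'
    split_ifs <;> first | (exfalso; grind) | simp
  · simp [h₀]

lemma Tmat_mulVec {p : ℕ} (h : p + 1 < 2 * n) (f : Lab n → F) (κ : Lab n) :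
    (Tmat n p).mulVec f κ =
      heckeDiag (κ ⟨p + 1, h⟩ < κ ⟨p, by omega⟩) * f κ +
      heckeOff (κ ⟨p + 1, h⟩ < κ ⟨p, by omega⟩) * f (posSwap p h κ) := by
  simp [Matrix.mulVec, dotProduct, Tmat_apply h, add_mul, Finset.sum_add_distrib, ite_mul]

lemma Tmat_eq_zero {p : ℕ} (h : ¬ p + 1 < 2 * n) : Tmat n p = 0 := by
  ext κ κ'
  simp [Tmat, h]

lemma Tmat_sq {p : ℕ} (h : p + 1 < 2 * n) :
    Tmat n p * Tmat n p = (tt - 1) • Tmat n p + tt • (1 : Mat n) := by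
  apply Matrix.mulVec_injective
  funext f κ
  simp only [← Matrix.mulVec_mulVec, Matrix.add_mulVec, Matrix.smul_mulVec, Matrix.one_mulVec,
    Pi.add_apply, Pi.smul_apply, Tmat_mulVec h, posSwap_left, posSwap_right, posSwap_posSwap,
    smul_eq_mul, heckeDiag, heckeOff]
  rcases lt_trichotomy (κ ⟨p + 1, h⟩) (κ ⟨p, by omega⟩) with hl | he | hl
  · simp [hl, not_lt.2 hl.le]
  · rw [posSwap_eq_self h κ he.symm]; simp [he]; ring
  · simp [hl, not_lt.2 hl.le]; ring

lemma Tmat_commute {p q : ℕ} (hpq : p + 2 ≤ q) : Commute (Tmat n p) (Tmat n q) := by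
  by_cases hq : q + 1 < 2 * n
  · have hp : p + 1 < 2 * n := by omega
    apply Matrix.mulVec_injective
    funext f κ
    simp only [← Matrix.mulVec_mulVec, Tmat_mulVec hp, Tmat_mulVec hq]
    rw [posSwap_of_ne hp κ (by omega : q < 2 * n) (by omega) (by omega),
      posSwap_of_ne hp κ hq (by omega) (by omega),
      posSwap_of_ne hq κ (by omega : p < 2 * n) (by omega) (by omega),
      posSwap_of_ne hq κ hp (by omega) (by omega), posSwap_comm hp hq hpq]
    ring
  · rw [Tmat_eq_zero hq]
    exact Commute.zero_right _

lemma Tmat_braid {p : ℕ} (h' : p + 2 < 2 * n) :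
    Tmat n p * Tmat n (p + 1) * Tmat n p = Tmat n (p + 1) * Tmat n p * Tmat n (p + 1) := by
  have h : p + 1 < 2 * n := by omega
  have h'' : p + 1 + 1 < 2 * n := h'
  apply Matrix.mulVec_injective
  funext f κ
  have hr (μ : Lab n) : posSwap p h μ ⟨p + 1 + 1, h''⟩ = μ ⟨p + 1 + 1, h''⟩ :=
    posSwap_of_ne h μ h'' (by omega) (by omega)
  have hl (μ : Lab n) : posSwap (p + 1) h'' μ ⟨p, by omega⟩ = μ ⟨p, by omega⟩ :=
    posSwap_of_ne h'' μ (by omega) (by omega) (by omega)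
  have hl₁ (μ : Lab n) : posSwap (p + 1) h'' μ ⟨p + 1, h⟩ = μ ⟨p + 1 + 1, h''⟩ :=
    posSwap_left h'' μ _
  simp only [← Matrix.mulVec_mulVec, Tmat_mulVec h, Tmat_mulVec h'', posSwap_left, posSwap_right,
    hr, hl, hl₁, posSwap_posSwap, posSwap_braid]
  have e₁ (he : κ ⟨p, by omega⟩ = κ ⟨p + 1, h⟩) : posSwap p h κ = κ ∧
      posSwap (p + 1) h'' (posSwap p h (posSwap (p + 1) h'' κ)) =
        posSwap p h (posSwap (p + 1) h'' κ) := by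
    rw [← posSwap_braid, posSwap_eq_self h κ he]
    exact ⟨rfl, rfl⟩
  have e₂ (he : κ ⟨p + 1, h⟩ = κ ⟨p + 1 + 1, h''⟩) : posSwap (p + 1) h'' κ = κ :=
    posSwap_eq_self h'' κ he
  have e₃ (he : κ ⟨p, by omega⟩ = κ ⟨p + 1 + 1, h''⟩) :
      posSwap p h (posSwap (p + 1) h'' κ) = posSwap (p + 1) h'' κ ∧
      posSwap (p + 1) h'' (posSwap p h κ) = posSwap p h κ :=
    ⟨posSwap_eq_self h _ (by rw [hl, hl₁, he]), posSwap_eq_self h'' _ (by rw [hr, posSwap_right, he])⟩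
  have e₄ := posSwap_posSwap h'' κ
  generalize κ ⟨p, _⟩ = a at *
  generalize κ ⟨p + 1, _⟩ = b at *
  generalize κ ⟨p + 1 + 1, _⟩ = c at *
  simp only [heckeDiag, heckeOff]
  rcases lt_trichotomy b a with h₁ | h₁ | h₁ <;> rcases lt_trichotomy c b with h₂ | h₂ | h₂ <;>
    rcases lt_trichotomy c a with h₃ | h₃ | h₃ <;>
    first
    | (exfalso; order)
    | (simp only [h₁, h₂, h₃, h₁.not_gt, h₂.not_gt, h₃.not_gt, lt_irrefl, if_true, if_false]
       try rw [(e₁ h₁.symm).2, (e₁ h₁.symm).1]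
       try rw [e₂ h₂.symm]
       try rw [(e₃ h₃.symm).1, (e₃ h₃.symm).2, e₄]
       ring)

end Positions

section YangBaxter

variable {k A : Type*} [CommRing k] [Ring A] [Algebra k A]

lemma yangBaxter_of_hecke {t : k} {a b : A} (ha : a * a = (t - 1) • a + t • (1 : A))
    (hb : b * b = (t - 1) • b + t • (1 : A)) (hab : a * b * a = b * a * b) (u v : k) :
    ((1 - t) • 1 + (1 - u) • a) * ((1 - t) • 1 + (1 - u * v) • b) *
        ((1 - t) • 1 + (1 - v) • a) =
      ((1 - t) • 1 + (1 - v) • b) * ((1 - t) • 1 + (1 - u * v) • a) *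
        ((1 - t) • 1 + (1 - u) • b) := by
  simp only [add_mul, mul_add, smul_mul_assoc, mul_smul_comm, one_mul, mul_one, smul_add,
    smul_smul, ha, hb, hab]
  module

lemma unitarity_of_hecke {t : k} {a : A} (ha : a * a = (t - 1) • a + t • (1 : A)) {u v : k}
    (huv : u * v = 1) :
    ((1 - t) • 1 + (1 - u) • a) * ((1 - t) • 1 + (1 - v) • a) =
      ((1 - u * t) * (1 - v * t)) • (1 : A) := by
  simp only [add_mul, mul_add, smul_mul_assoc, mul_smul_comm, one_mul, mul_one, smul_add,
    smul_smul, ha]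
  match_scalars
  · linear_combination (t - t ^ 2) * huv
  · linear_combination (t - 1) * huv

end YangBaxter

section LabelHecke

variable {n : ℕ}

/-- The labeling with the values `i` and `i + 1` exchanged. -/
def valSwap (i : ℕ) (hi : i + 1 < n + 1) (κ : Lab n) : Lab n :=
  fun j => Equiv.swap (⟨i, by omega⟩ : Fin (n + 1)) ⟨i + 1, hi⟩ (κ j)

/-- Each of the values `i` and `i + 1` is taken at exactly one position. -/
def IsSimple (i : ℕ) (κ : Lab n) : Prop :=
  ∃ P Q : Fin (2 * n), (∀ j, (κ j : ℕ) = i ↔ j = P) ∧ ∀ j, (κ j : ℕ) = i + 1 ↔ j = Q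

/-- The value `i + 1` occurs before the value `i`. -/
def IsDescent (i : ℕ) (κ : Lab n) : Prop :=
  ∃ P Q : Fin (2 * n), (κ P : ℕ) = i ∧ (κ Q : ℕ) = i + 1 ∧ Q < P

open scoped Classical in
/-- The right action of the Hecke generator, exchanging the values `i` and `i + 1`, on the
labelings taking each of these values exactly once. -/
def labelHecke (i : ℕ) (hi : i + 1 < n + 1) : Mat n :=
  Matrix.of fun κ κ' => if IsSimple i κ then
    (if κ' = κ then heckeDiag (IsDescent i κ) else 0) +
    (if κ' = valSwap i hi κ then heckeOff (IsDescent i κ) else 0) else 0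

open scoped Classical in
lemma labelHecke_mulVec {i : ℕ} (hi : i + 1 < n + 1) (f : Lab n → F) (κ : Lab n) :
    (labelHecke i hi).mulVec f κ = if IsSimple i κ then
      heckeDiag (IsDescent i κ) * f κ + heckeOff (IsDescent i κ) * f (valSwap i hi κ) else 0 := by
  by_cases h : IsSimple i κ <;>
  simp [Matrix.mulVec, dotProduct, labelHecke, h, add_mul, Finset.sum_add_distrib, ite_mul]

lemma isDescent_iff {i : ℕ} {κ : Lab n} {P Q : Fin (2 * n)} (hP : ∀ j, (κ j : ℕ) = i ↔ j = P)
    (hQ : ∀ j, (κ j : ℕ) = i + 1 ↔ j = Q) : IsDescent i κ ↔ Q < P := by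
  simp [IsDescent, hP, hQ]

lemma val_posSwap_iff {p : ℕ} (h : p + 1 < 2 * n) {κ : Lab n} {P : Fin (2 * n)} {v : ℕ}
    (hP : ∀ j, (κ j : ℕ) = v ↔ j = P) (j : Fin (2 * n)) :
    (posSwap p h κ j : ℕ) = v ↔ j = Equiv.swap ⟨p, by omega⟩ ⟨p + 1, h⟩ P := by
  rw [posSwap, Function.comp_apply, hP, Equiv.swap_apply_eq_iff]

lemma isSimple_posSwap_iff {i p : ℕ} (h : p + 1 < 2 * n) (κ : Lab n) :
    IsSimple i (posSwap p h κ) ↔ IsSimple i κ := by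
  have key (μ : Lab n) (hμ : IsSimple i μ) : IsSimple i (posSwap p h μ) := by
    obtain ⟨P, Q, hP, hQ⟩ := hμ
    exact ⟨_, _, val_posSwap_iff h hP, val_posSwap_iff h hQ⟩
  exact ⟨fun hκ => by simpa only [posSwap_posSwap] using key _ hκ, key κ⟩

lemma valSwap_posSwap {i p : ℕ} (hi : i + 1 < n + 1) (h : p + 1 < 2 * n) (κ : Lab n) :
    valSwap i hi (posSwap p h κ) = posSwap p h (valSwap i hi κ) := rfl

lemma valSwap_lt_valSwap_iff {i : ℕ} (hi : i + 1 < n + 1) (κ : Lab n) {a b : Fin (2 * n)}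
    (h : ¬ ((κ a : ℕ) = i ∧ (κ b : ℕ) = i + 1)) (h' : ¬ ((κ b : ℕ) = i ∧ (κ a : ℕ) = i + 1)) :
    valSwap i hi κ a < valSwap i hi κ b ↔ κ a < κ b := by
  simp only [valSwap, Equiv.swap_apply_def, Fin.ext_iff, Fin.lt_def, apply_ite Fin.val]
  split_ifs <;> omega

lemma valSwap_eq_posSwap {i p : ℕ} (hi : i + 1 < n + 1) (h : p + 1 < 2 * n) {κ : Lab n}
    (hκ : IsSimple i κ)
    (hp : (κ ⟨p, by omega⟩ : ℕ) = i ∧ (κ ⟨p + 1, h⟩ : ℕ) = i + 1 ∨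
      (κ ⟨p + 1, h⟩ : ℕ) = i ∧ (κ ⟨p, by omega⟩ : ℕ) = i + 1) :
    valSwap i hi κ = posSwap p h κ := by
  obtain ⟨P, Q, hP, hQ⟩ := hκ
  rw [eq_posSwap_iff]
  refine ⟨fun j h₁ h₂ => ?_, ?_, ?_⟩
  · refine (Equiv.swap_apply_of_ne_of_ne ?_ ?_).symm
    · rw [Ne, Fin.ext_iff, hP]
      simp only [hP, hQ] at hp
      rintro rfl
      rcases hp with hp | hp <;> have := congrArg Fin.val hp.1 <;> simp_all
    · rw [Ne, Fin.ext_iff, hQ]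
      simp only [hP, hQ] at hp
      rintro rfl
      rcases hp with hp | hp <;> have := congrArg Fin.val hp.2 <;> simp_all
  all_goals
    simp only [valSwap, Equiv.swap_apply_def, Fin.ext_iff, apply_ite Fin.val]
    split_ifs <;> omega

lemma isDescent_iff_of_adjacent {i p : ℕ} (h : p + 1 < 2 * n) {κ : Lab n} (hκ : IsSimple i κ)
    (hp : (κ ⟨p, by omega⟩ : ℕ) = i ∧ (κ ⟨p + 1, h⟩ : ℕ) = i + 1 ∨
      (κ ⟨p + 1, h⟩ : ℕ) = i ∧ (κ ⟨p, by omega⟩ : ℕ) = i + 1) :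
    IsDescent i κ ↔ κ ⟨p + 1, h⟩ < κ ⟨p, by omega⟩ := by
  obtain ⟨P, Q, hP, hQ⟩ := hκ
  rw [isDescent_iff hP hQ, Fin.lt_def, Fin.lt_def]
  rcases hp with ⟨h₁, h₂⟩ | ⟨h₁, h₂⟩ <;> rw [h₁, h₂, ← (hP _).1 h₁, ← (hQ _).1 h₂] <;> simp

lemma labelHecke_commute_Tmat {i : ℕ} (hi : i + 1 < n + 1) (p : ℕ) :
    Commute (labelHecke i hi) (Tmat n p) := by
  by_cases h : p + 1 < 2 * n
  swap
  · rw [Tmat_eq_zero h]; exact Commute.zero_right _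
  unfold Commute SemiconjBy
  apply Matrix.mulVec_injective
  funext f κ
  simp only [← Matrix.mulVec_mulVec, Tmat_mulVec h, labelHecke_mulVec, valSwap_posSwap]
  have hs := isSimple_posSwap_iff (i := i) h κ
  by_cases hκ : IsSimple i κ
  swap
  · rw [if_neg hκ, if_neg hκ, if_neg (mt hs.1 hκ), mul_zero, mul_zero, add_zero]
  rw [if_pos hκ, if_pos hκ, if_pos (hs.2 hκ)]
  obtain ⟨P, Q, hP, hQ⟩ := id hκ
  have hPQ : P ≠ Q := by
    rintro rfl
    have h₁ := (hP P).2 rfl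
    have h₂ := (hQ P).2 rfl
    omega
  have hd := isDescent_iff hP hQ
  have hd' := isDescent_iff (val_posSwap_iff h hP) (val_posSwap_iff h hQ)
  by_cases hp : (κ ⟨p, by omega⟩ : ℕ) = i ∧ (κ ⟨p + 1, h⟩ : ℕ) = i + 1 ∨
      (κ ⟨p + 1, h⟩ : ℕ) = i ∧ (κ ⟨p, by omega⟩ : ℕ) = i + 1
  · rw [valSwap_eq_posSwap hi h hκ hp, posSwap_posSwap]
    have e₁ := isDescent_iff_of_adjacent h hκ hp
    have e₂ := isDescent_iff_of_adjacent h (hs.2 hκ)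
      (by rw [posSwap_left, posSwap_right]; exact hp.symm)
    rw [e₁, e₂]
  · push Not at hp
    have e' := valSwap_lt_valSwap_iff hi κ (a := ⟨p + 1, h⟩) (b := ⟨p, by omega⟩) (by tauto)
      (by tauto)
    have e : IsDescent i (posSwap p h κ) ↔ IsDescent i κ := by
      rw [hd, hd']
      simp only [hP, hQ, ne_eq] at hp
      simp only [Equiv.swap_apply_def, Fin.ext_iff, Fin.lt_def, apply_ite Fin.val] at hp ⊢
      split_ifs <;> omega
    rw [e, e']
    ring

end LabelHecke

section Exchange

variable {n : ℕ}

lemma Rmat_commute {p q : ℕ} (hpq : p + 2 ≤ q) (u v : F) :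
    Commute (Rmat n p u) (Rmat n q v) := by
  have h₁ : Commute (1 : Mat n) (Rmat n q v) := Commute.one_left _
  have h₂ : Commute (Tmat n p) ((1 - tt) • (1 : Mat n)) :=
    (Commute.one_right (Tmat n p)).smul_right (1 - tt)
  have h₃ : Commute (Tmat n p) (Rmat n q v) :=
    h₂.add_right ((Tmat_commute hpq).smul_right (1 - v))
  exact (h₁.smul_left (1 - tt)).add_left (h₃.smul_left (1 - u))

lemma Rmat_yangBaxter {p : ℕ} (hp : p + 2 < 2 * n) {u v w : F} (hw : w = u * v) :
    Rmat n p u * Rmat n (p + 1) w * Rmat n p v =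
      Rmat n (p + 1) v * Rmat n p w * Rmat n (p + 1) u := by
  subst hw
  exact yangBaxter_of_hecke (Tmat_sq (by omega)) (Tmat_sq hp) (Tmat_braid hp) u v

/-- The product `Ř_{j+m-1}(x_{m-1}/y) ⋯ Ř_j(x_0/y)`. -/
def column (n : ℕ) (x : ℕ → F) (y : F) (j : ℕ) : ℕ → Mat n
  | 0 => 1
  | m + 1 => Rmat n (j + m) (x m / y) * column n x y j m

lemma column_eq_prod (x : ℕ → F) (y : F) (j m : ℕ) :
    ((List.range m).map fun r => Rmat n (j + (m - 1 - r)) (x (m - 1 - r) / y)).prod =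
      column n x y j m := by
  induction m with
  | zero => rfl
  | succ m ih =>
    rw [List.range_succ_eq_map, List.map_cons, List.prod_cons, column, ← ih, List.map_map]
    congr 2
    refine List.map_congr_left fun r _ => ?_
    simp [Nat.sub_sub, Nat.add_comm]

/-- The product of the first `m` columns. -/
def columns (n : ℕ) (x y : ℕ → F) : ℕ → Mat n
  | 0 => 1
  | m + 1 => columns n x y m * column n x (y m) m n

lemma Zmat_eq_columns (x y : ℕ → F) : Zmat n x y = columns n x y n := by
  have key (m : ℕ) : ((List.range m).map fun j => column n x (y j) j n).prod =
      columns n x y m := by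
    induction m with
    | zero => rfl
    | succ m ih => rw [List.prod_range_succ, ih, columns]
  simp only [Zmat, column_eq_prod, key]

lemma column_congr {x x' : ℕ → F} (y : F) (j : ℕ) {m : ℕ} (h : ∀ k < m, x k = x' k) :
    column n x y j m = column n x' y j m := by
  induction m with
  | zero => rfl
  | succ m ih => rw [column, column, h m (by omega), ih fun k hk => h k (by omega)]

lemma columns_congr {x x' y y' : ℕ → F} {m : ℕ} (hx : ∀ k < n, x k = x' k)
    (hy : ∀ k < m, y k = y' k) : columns n x y m = columns n x' y' m := by
  induction m with
  | zero => rfl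
  | succ m ih =>
    rw [columns, columns, hy m (by omega), ih fun k hk => hy k (by omega),
      column_congr _ _ hx]

lemma column_commute_of_le {x : ℕ → F} {y u : F} {j p m : ℕ} (h : j + m + 1 ≤ p) :
    Commute (column n x y j m) (Rmat n p u) := by
  induction m with
  | zero => exact Commute.one_left _
  | succ m ih => exact (Rmat_commute (by omega) _ _).mul_left (ih (by omega))

lemma column_commute_of_ge {x : ℕ → F} {y u : F} {j p m : ℕ} (h : p + 2 ≤ j) :
    Commute (column n x y j m) (Rmat n p u) := by
  induction m with
  | zero => exact Commute.one_left _
  | succ m ih => exact (Rmat_commute (by omega) _ _).symm.mul_left ih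

lemma columns_commute {x y : ℕ → F} {u : F} {p m : ℕ} (h : m + n ≤ p) :
    Commute (columns n x y m) (Rmat n p u) := by
  induction m with
  | zero => exact Commute.one_left _
  | succ m ih => exact (ih (by omega)).mul_left (column_commute_of_le (by omega))

lemma Rmat_mul_column {x : ℕ → F} {y : F} {i j m : ℕ} (hx : x i ≠ 0) (hm : i + 2 ≤ m)
    (hj : j + i + 2 < 2 * n) :
    Rmat n (j + i) (x (i + 1) / x i) * column n x y j m =
      column n (x ∘ Equiv.swap i (i + 1)) y j m * Rmat n (j + i + 1) (x (i + 1) / x i) := by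
  induction m, hm using Nat.le_induction with
  | base =>
    have hc : column n (x ∘ Equiv.swap i (i + 1)) y j i = column n x y j i :=
      column_congr _ _ fun k hk => by
        simp [Equiv.swap_apply_of_ne_of_ne (by omega : k ≠ i) (by omega : k ≠ i + 1)]
    have hyb := Rmat_yangBaxter hj (u := x (i + 1) / x i) (v := x i / y) (w := x (i + 1) / y)
      (by field_simp)
    have hcomm : Commute (column n x y j i) (Rmat n (j + i + 1) (x (i + 1) / x i)) :=
      column_commute_of_le (by omega)
    simp only [column, hc, Function.comp_apply, Equiv.swap_apply_left, Equiv.swap_apply_right,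
      ← add_assoc]
    rw [mul_assoc, mul_assoc, hcomm.eq, ← mul_assoc, ← mul_assoc, hyb]
    simp only [mul_assoc]
  | succ m hm ih =>
    have hcomm := Rmat_commute (n := n) (p := j + i) (q := j + m) (by omega)
      (x (i + 1) / x i) (x m / y)
    have hxm : (x ∘ Equiv.swap i (i + 1)) m = x m := by
      simp [Equiv.swap_apply_of_ne_of_ne (by omega : m ≠ i) (by omega : m ≠ i + 1)]
    rw [column, column, hxm, ← mul_assoc, hcomm.eq, mul_assoc, ih, mul_assoc]

lemma column_mul_column_mul_Rmat {x : ℕ → F} {y y' : F} {j m : ℕ} (hy : y ≠ 0)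
    (hj : j + m + 1 < 2 * n) :
    column n x y j m * column n x y' (j + 1) m * Rmat n j (y / y') =
      Rmat n (j + m) (y / y') * (column n x y' j m * column n x y (j + 1) m) := by
  induction m with
  | zero => simp [column]
  | succ m ih =>
    have h₁ : Commute (column n x y j m) (Rmat n (j + 1 + m) (x m / y')) :=
      column_commute_of_le (by omega)
    have h₂ : Commute (column n x y' j m) (Rmat n (j + 1 + m) (x m / y)) :=
      column_commute_of_le (by omega)
    have hyb := Rmat_yangBaxter (n := n) (p := j + m) (by omega) (u := x m / y) (v := y / y')
      (w := x m / y') (by field_simp)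
    have e : j + 1 + m = j + m + 1 := by omega
    calc _ = Rmat n (j + m) (x m / y) * (column n x y j m * Rmat n (j + 1 + m) (x m / y')) *
          column n x y' (j + 1) m * Rmat n j (y / y') := by simp only [column, mul_assoc]
      _ = Rmat n (j + m) (x m / y) * Rmat n (j + 1 + m) (x m / y') *
          (column n x y j m * column n x y' (j + 1) m * Rmat n j (y / y')) := by
        rw [h₁.eq]; simp only [mul_assoc]
      _ = Rmat n (j + m) (x m / y) * Rmat n (j + m + 1) (x m / y') * Rmat n (j + m) (y / y') *
          (column n x y' j m * column n x y (j + 1) m) := by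
        rw [ih (by omega), e]; simp only [mul_assoc]
      _ = Rmat n (j + m + 1) (y / y') * Rmat n (j + m) (x m / y') *
          (Rmat n (j + 1 + m) (x m / y) * column n x y' j m) * column n x y (j + 1) m := by
        rw [hyb, e]; simp only [mul_assoc]
      _ = _ := by
        rw [← h₂.eq]; simp only [column, mul_assoc, ← add_assoc]

lemma Rmat_mul_columns {x y : ℕ → F} {i m : ℕ} (hx : x i ≠ 0) (hi : i + 1 < n) (hm : m ≤ n) :
    Rmat n i (x (i + 1) / x i) * columns n x y m =
      columns n (x ∘ Equiv.swap i (i + 1)) y m * Rmat n (m + i) (x (i + 1) / x i) := by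
  induction m with
  | zero => simp [columns]
  | succ m ih =>
    rw [columns, columns, ← mul_assoc, ih (by omega), mul_assoc,
      Rmat_mul_column hx (by omega) (by omega), mul_assoc]
    congr 3
    omega

lemma columns_mul_Rmat {x y : ℕ → F} {i m : ℕ} (hy : y i ≠ 0) (hi : i + 1 < n)
    (hm : i + 2 ≤ m) :
    columns n x y m * Rmat n i (y i / y (i + 1)) =
      Rmat n (n + i) (y i / y (i + 1)) * columns n x (y ∘ Equiv.swap i (i + 1)) m := by
  induction m, hm using Nat.le_induction with
  | base =>
    have hc : columns n x (y ∘ Equiv.swap i (i + 1)) i = columns n x y i :=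
      columns_congr (fun _ _ => rfl) fun k hk => by
        simp [Equiv.swap_apply_of_ne_of_ne (by omega : k ≠ i) (by omega : k ≠ i + 1)]
    have hcomm : Commute (columns n x y i) (Rmat n (i + n) (y i / y (i + 1))) :=
      columns_commute (by omega)
    have hcc := column_mul_column_mul_Rmat (n := n) (x := x) (y' := y (i + 1)) (j := i) (m := n)
      hy (by omega)
    simp only [columns, hc, Function.comp_apply, Equiv.swap_apply_left, Equiv.swap_apply_right]
    rw [mul_assoc (columns n x y i), mul_assoc (columns n x y i), hcc, ← mul_assoc, hcomm.eq,
      add_comm i n]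
    simp only [mul_assoc]
  | succ m hm ih =>
    have hym : (y ∘ Equiv.swap i (i + 1)) m = y m := by
      simp [Equiv.swap_apply_of_ne_of_ne (by omega : m ≠ i) (by omega : m ≠ i + 1)]
    have hcomm : Commute (column n x (y m) m n) (Rmat n i (y i / y (i + 1))) :=
      column_commute_of_ge (by omega)
    rw [columns, columns, hym, mul_assoc, hcomm.eq, ← mul_assoc, ih, mul_assoc]

lemma Rmat_mul_Zmat_mul_Rmat {x y : ℕ → F} {i : ℕ} (hx : x i ≠ 0) (hy : y i ≠ 0)
    (hi : i + 1 < n) :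
    Rmat n i (x (i + 1) / x i) * (Zmat n x y * Rmat n i (y i / y (i + 1))) =
      Rmat n (n + i) (y i / y (i + 1)) *
        Zmat n (x ∘ Equiv.swap i (i + 1)) (y ∘ Equiv.swap i (i + 1)) *
        Rmat n (n + i) (x (i + 1) / x i) := by
  have hcomm := Rmat_commute (n := n) (p := i) (q := n + i) (by omega)
    (x (i + 1) / x i) (y i / y (i + 1))
  rw [Zmat_eq_columns, columns_mul_Rmat hy hi (by omega), ← mul_assoc, hcomm.eq, mul_assoc,
    Rmat_mul_columns hx hi le_rfl, Zmat_eq_columns, mul_assoc]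

lemma labelHecke_commute_Rmat {i : ℕ} (hi : i + 1 < n + 1) (p : ℕ) (u : F) :
    Commute (labelHecke i hi) (Rmat n p u) :=
  Commute.add_right ((Commute.one_right (_ : Mat n)).smul_right _)
    ((labelHecke_commute_Tmat hi p).smul_right _)

lemma labelHecke_commute_Zmat {i : ℕ} (hi : i + 1 < n + 1) (x y : ℕ → F) :
    Commute (labelHecke i hi) (Zmat n x y) := by
  refine Commute.list_prod_right _ _ fun A hA => ?_
  obtain ⟨j, -, rfl⟩ := List.mem_map.1 hA
  refine Commute.list_prod_right _ _ fun B hB => ?_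
  obtain ⟨r, -, rfl⟩ := List.mem_map.1 hB
  exact labelHecke_commute_Rmat hi _ _

end Exchange

section Specialization

variable {n : ℕ}

lemma valSwap_valSwap {i : ℕ} (hi : i + 1 < n + 1) (κ : Lab n) :
    valSwap i hi (valSwap i hi κ) = κ := by
  funext j
  simp [valSwap]

lemma labelHecke_apply_of_adjacent {i p : ℕ} (hi : i + 1 < n + 1) (h : p + 1 < 2 * n) {κ : Lab n}
    (hκ : IsSimple i κ)
    (hp : (κ ⟨p, by omega⟩ : ℕ) = i ∧ (κ ⟨p + 1, h⟩ : ℕ) = i + 1 ∨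
      (κ ⟨p + 1, h⟩ : ℕ) = i ∧ (κ ⟨p, by omega⟩ : ℕ) = i + 1) (κ' : Lab n) :
    labelHecke i hi κ κ' = Tmat n p κ κ' := by
  rw [Tmat_apply h, labelHecke, Matrix.of_apply, if_pos hκ, valSwap_eq_posSwap hi h hκ hp,
    isDescent_iff_of_adjacent h hκ hp]

lemma labelHecke_apply_of_adjacent_right {i p : ℕ} (hi : i + 1 < n + 1) (h : p + 1 < 2 * n)
    {κ' : Lab n} (hκ : IsSimple i κ')
    (hp : (κ' ⟨p, by omega⟩ : ℕ) = i ∧ (κ' ⟨p + 1, h⟩ : ℕ) = i + 1 ∨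
      (κ' ⟨p + 1, h⟩ : ℕ) = i ∧ (κ' ⟨p, by omega⟩ : ℕ) = i + 1) (κ : Lab n) :
    labelHecke i hi κ κ' = Tmat n p κ κ' := by
  by_cases h₁ : κ = κ'
  · subst h₁
    exact labelHecke_apply_of_adjacent hi h hκ hp _
  by_cases h₂ : κ = posSwap p h κ'
  · subst h₂
    refine labelHecke_apply_of_adjacent hi h ((isSimple_posSwap_iff h κ').2 hκ) ?_ _
    rw [posSwap_left, posSwap_right]
    exact hp.symm
  · have h₃ : κ' ≠ posSwap p h κ := by
      rintro rfl
      exact h₂ (posSwap_posSwap h κ).symm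
    have h₄ : κ' ≠ valSwap i hi κ := by
      rintro rfl
      rw [← valSwap_eq_posSwap hi h hκ hp, valSwap_valSwap] at h₂
      exact h₂ rfl
    simp [Tmat_apply h, labelHecke, h₃, h₄, Ne.symm h₁]

lemma val_labP_one (j : Fin (2 * n)) : (labP n 1 j : ℕ) = if (j : ℕ) < n then (j : ℕ) else n := by
  unfold labP
  split_ifs <;> simp

lemma isSimple_labP_one {i : ℕ} (hi : i + 1 < n) : IsSimple i (labP n 1) := by
  refine ⟨⟨i, by omega⟩, ⟨i + 1, by omega⟩, fun j => ?_, fun j => ?_⟩ <;>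
  · rw [val_labP_one, Fin.ext_iff]
    dsimp only
    split_ifs <;> omega

lemma labP_one_adjacent {i : ℕ} (hi : i + 1 < n) :
    (labP n 1 ⟨i, by omega⟩ : ℕ) = i ∧ (labP n 1 ⟨i + 1, by omega⟩ : ℕ) = i + 1 := by
  rw [val_labP_one, val_labP_one, if_pos (by simp only; omega), if_pos hi]
  exact ⟨rfl, rfl⟩

/-- Cyclicity of the `(1, 1)` matrix element: `Ř_i(u)` can be moved from the left to the right
of any operator commuting with the right Hecke action. -/
lemma Rmat_mul_apply_labP_one {i : ℕ} (hi : i + 1 < n) {M : Mat n}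
    (hM : Commute (labelHecke i (by omega)) M) (u : F) :
    (Rmat n i u * M) (labP n 1) (labP n 1) = (M * Rmat n i u) (labP n 1) (labP n 1) := by
  have h : i + 1 < 2 * n := by omega
  have hi' : i + 1 < n + 1 := by omega
  have h₁ : (Tmat n i * M) (labP n 1) (labP n 1) =
      (labelHecke i hi' * M) (labP n 1) (labP n 1) := by
    simp only [Matrix.mul_apply,
      labelHecke_apply_of_adjacent hi' h (isSimple_labP_one hi) (Or.inl (labP_one_adjacent hi))]
  have h₂ : (M * Tmat n i) (labP n 1) (labP n 1) =
      (M * labelHecke i hi') (labP n 1) (labP n 1) := by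
    simp only [Matrix.mul_apply,
      labelHecke_apply_of_adjacent_right hi' h (isSimple_labP_one hi)
        (Or.inl (labP_one_adjacent hi))]
  simp only [Rmat, add_mul, mul_add, smul_mul_assoc, mul_smul_comm, one_mul, mul_one,
    Matrix.add_apply, Matrix.smul_apply, h₁, h₂, hM.eq]

lemma Tmat_apply_of_eq {p : ℕ} (h : p + 1 < 2 * n) {κ : Lab n}
    (he : κ ⟨p, by omega⟩ = κ ⟨p + 1, h⟩) (κ' : Lab n) :
    Tmat n p κ κ' = tt * (1 : Mat n) κ κ' := by
  rw [Tmat_apply h, posSwap_eq_self h κ he, he, Matrix.one_apply]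
  by_cases hk : κ = κ' <;> simp [hk, Ne.symm, heckeDiag, heckeOff]

lemma Tmat_apply_of_eq_right {p : ℕ} (h : p + 1 < 2 * n) {κ' : Lab n}
    (he : κ' ⟨p, by omega⟩ = κ' ⟨p + 1, h⟩) (κ : Lab n) :
    Tmat n p κ κ' = tt * (1 : Mat n) κ κ' := by
  by_cases hk : κ = κ'
  · subst hk
    exact Tmat_apply_of_eq h he _
  · have h₃ : κ' ≠ posSwap p h κ := by
      rintro rfl
      rw [posSwap_left, posSwap_right] at he
      exact hk (posSwap_eq_self h κ he.symm).symm
    simp [Tmat_apply h, h₃, hk, Ne.symm hk]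

lemma Rmat_mul_mul_Rmat_apply_labP_one {p : ℕ} (hn : n ≤ p) (h : p + 1 < 2 * n) (M : Mat n)
    (u v : F) :
    (Rmat n p u * M * Rmat n p v) (labP n 1) (labP n 1) =
      (1 - u * tt) * (1 - v * tt) * M (labP n 1) (labP n 1) := by
  have he : labP n 1 ⟨p, by omega⟩ = labP n 1 ⟨p + 1, h⟩ := by
    rw [Fin.ext_iff, val_labP_one, val_labP_one, if_neg (by simp only; omega),
      if_neg (by simp only; omega)]
  have hl (N : Mat n) : (Rmat n p u * N) (labP n 1) (labP n 1) =
      (1 - u * tt) * N (labP n 1) (labP n 1) := by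
    have : (Tmat n p * N) (labP n 1) (labP n 1) = tt * N (labP n 1) (labP n 1) := by
      conv_rhs => rw [← one_mul N]
      simp only [Matrix.mul_apply, Tmat_apply_of_eq h he, Finset.mul_sum, mul_assoc]
    simp only [Rmat, add_mul, smul_mul_assoc, one_mul, Matrix.add_apply, Matrix.smul_apply, this,
      smul_eq_mul]
    ring
  have hr (N : Mat n) : (N * Rmat n p v) (labP n 1) (labP n 1) =
      (1 - v * tt) * N (labP n 1) (labP n 1) := by
    have : (N * Tmat n p) (labP n 1) (labP n 1) = tt * N (labP n 1) (labP n 1) := by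
      conv_rhs => rw [← mul_one N]
      simp only [Matrix.mul_apply, Tmat_apply_of_eq_right h he, Finset.mul_sum, mul_left_comm]
    simp only [Rmat, mul_add, mul_smul_comm, mul_one, Matrix.add_apply, Matrix.smul_apply, this,
      smul_eq_mul]
    ring
  rw [hr, hl]
  ring

lemma qq_ne_zero : qq ≠ 0 := by
  rw [qq, gen, Ne, FaithfulSMul.algebraMap_eq_zero_iff]
  exact MvPolynomial.X_ne_zero _

lemma xx_ne_zero (a : ℕ) : xx a ≠ 0 := by
  rw [xx, gen, Ne, FaithfulSMul.algebraMap_eq_zero_iff]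
  exact MvPolynomial.X_ne_zero _

lemma xx_sub_xx_mul_tt_ne_zero (a b : ℕ) : xx a - xx b * tt ≠ 0 := by
  rw [xx, xx, tt, gen, gen, gen, ← map_mul, ← map_sub, Ne, FaithfulSMul.algebraMap_eq_zero_iff]
  intro h
  have := congrArg (MvPolynomial.eval fun k : ℕ => if k = 1 then (0 : ℚ) else 1) h
  simp at this
  omega

lemma pf1_comp_swap {x : ℕ → F} {i : ℕ} (hi : i + 1 < n) (hx : x i ≠ 0) (hx' : x (i + 1) ≠ 0)
    (h : x i - x (i + 1) * tt ≠ 0) (h' : x (i + 1) - x i * tt ≠ 0) :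
    pf1 n (x ∘ Equiv.swap i (i + 1)) = pf1 n x := by
  have hex := Rmat_mul_Zmat_mul_Rmat (n := n) (y := fun k => qq * x k) hx
    (mul_ne_zero qq_ne_zero hx) hi
  have hr : qq * x i / (qq * x (i + 1)) = x i / x (i + 1) :=
    mul_div_mul_left _ _ qq_ne_zero
  have hentry := congrFun (congrFun hex (labP n 1)) (labP n 1)
  simp only [hr] at hentry
  rw [Rmat_mul_apply_labP_one hi ((labelHecke_commute_Zmat _ _ _).mul_right
      (labelHecke_commute_Rmat _ _ _)), mul_assoc,
    Rmat_mul_mul_Rmat_apply_labP_one (by omega) (by omega), Rmat, Rmat,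
    unitarity_of_hecke (Tmat_sq (by omega)) (by field_simp), mul_smul_comm, mul_one,
    Matrix.smul_apply, smul_eq_mul] at hentry
  have hc : (1 - x i / x (i + 1) * tt) * (1 - x (i + 1) / x i * tt) ≠ 0 := by
    refine mul_ne_zero ?_ ?_
    · rw [show 1 - x i / x (i + 1) * tt = (x (i + 1) - x i * tt) / x (i + 1) by field_simp]
      exact div_ne_zero h' hx'
    · rw [show 1 - x (i + 1) / x i * tt = (x i - x (i + 1) * tt) / x i by field_simp]
      exact div_ne_zero h hx
  exact congrArg (alpha n * ·) (mul_left_cancel₀ hc hentry).symm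

lemma pf1_congr {x x' : ℕ → F} (h : ∀ k < n, x k = x' k) : pf1 n x = pf1 n x' := by
  rw [pf1, pf1, Zmat_eq_columns, Zmat_eq_columns,
    columns_congr h fun k hk => congrArg (qq * ·) (h k hk)]

lemma pf1_perm (σ : Equiv.Perm (Fin n)) :
    pf1 n (fun k => if h : k < n then xx (σ ⟨k, h⟩ : Fin n) else xx k) = pf1 n xx := by
  obtain _ | m := n
  · exact pf1_congr fun k hk => absurd hk (Nat.not_lt_zero k)
  have hσ : σ ∈ Submonoid.closure
      (Set.range fun i : Fin m => Equiv.swap i.castSucc i.succ) := by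
    rw [Equiv.Perm.mclosure_swap_castSucc_succ]
    exact Submonoid.mem_top σ
  induction hσ using Submonoid.closure_induction_right with
  | one => exact pf1_congr fun k hk => by simp [hk]
  | mul_right τ _ s hs ih =>
    obtain ⟨i, rfl⟩ := hs
    have hx (k : ℕ) : ∃ a, (if h : k < m + 1 then xx (τ ⟨k, h⟩ : Fin (m + 1)) else xx k) = xx a := by
      split_ifs <;> exact ⟨_, rfl⟩
    obtain ⟨a, ha⟩ := hx i
    obtain ⟨b, hb⟩ := hx (i + 1)
    have hswap := pf1_comp_swap (n := m + 1) (i := i)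
      (x := fun k => if h : k < m + 1 then xx (τ ⟨k, h⟩ : Fin (m + 1)) else xx k) (by omega)
      (by simp only [ha]; exact xx_ne_zero _) (by simp only [hb]; exact xx_ne_zero _)
      (by simp only [ha, hb]; exact xx_sub_xx_mul_tt_ne_zero _ _)
      (by simp only [ha, hb]; exact xx_sub_xx_mul_tt_ne_zero _ _)
    refine (pf1_congr fun k hk => ?_).trans (hswap.trans ih)
    have hv : Equiv.swap (i : ℕ) (i + 1) k =
        (Equiv.swap i.castSucc i.succ (⟨k, hk⟩ : Fin (m + 1)) : ℕ) := by
      simp only [Equiv.swap_apply_def, Fin.ext_iff, apply_ite Fin.val, Fin.val_castSucc,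
        Fin.val_succ]
    simp only [Function.comp_apply, hv, dif_pos hk, Equiv.Perm.mul_apply, Fin.is_lt, dif_pos,
      Fin.eta]

end Specialization

/-- `f(1ₙ)` is a symmetric function of `x₁,…,xₙ`. -/
theorem statement8 (n : ℕ) (hn : 1 ≤ n) (σ : Equiv.Perm (Fin n)) :
    pf1 n (fun k => if h : k < n then xx ((σ ⟨k, h⟩ : Fin n) : ℕ) else xx k) = pf1 n xx := by
  exact pf1_perm σ
end
end

section
/- Let w ∈ S_{2n} and let (i₁,…,i_k) be any reduced word for w, i.e. w = s_{i₁}⋯s_{i_k} with k = ℓ(w), and set T_w = T_{i₁}∘⋯∘T_{i_k}. Then: (a) ⟨1| ∘ T_w = t^{ℓ(w)} · ⟨w|; (b) writing w⁻¹ = w₁·w₂ where w₁ lies in the subgroup S^{(2)} of permutations of {1,…,2n} fixing 1,…,n pointwise and w₂ is the minimal-length representative of the coset S^{(2)}·w⁻¹, one has T_w |1⟩ = t^{ℓ(w₁)} · |w₂⟩. (Here the kets |v⟩ depend only on the coset S^{(2)}·v.) -/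
open Finset

noncomputable section

/-- the labeling `(ω̄(u(1)),…,ω̄(u(2n)))` of `|u⟩` for `u ∈ S_{2n}`. -/
def labP2 (n : ℕ) (u : Equiv.Perm (Fin (2 * n))) : Lab n := fun p =>
  if h : (u p : ℕ) < n then ⟨(u p : ℕ), by omega⟩ else Fin.last n

/-- The adjacent transposition of `e` and `e + 1`, or the identity if `e + 1` is out of range. -/
def adjSwap (N e : ℕ) : Equiv.Perm (Fin N) :=
  if h : e + 1 < N then Equiv.swap ⟨e, by omega⟩ ⟨e + 1, h⟩ else 1

/-- The inversions of `v` whose smaller value is at least `m`. -/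
def inversionsGe {N : ℕ} (m : ℕ) (v : Equiv.Perm (Fin N)) : Finset (Fin N × Fin N) :=
  Finset.univ.filter fun p => p.1 < p.2 ∧ v p.2 < v p.1 ∧ m ≤ (v p.2 : ℕ)

section Length

variable {N : ℕ}

lemma mem_inversionsGe {m : ℕ} {v : Equiv.Perm (Fin N)} {p : Fin N × Fin N} :
    p ∈ inversionsGe m v ↔ p.1 < p.2 ∧ v p.2 < v p.1 ∧ m ≤ (v p.2 : ℕ) := by
  simp [inversionsGe]

lemma ell_eq_card_inversionsGe (v : Equiv.Perm (Fin N)) : ell v = (inversionsGe 0 v).card := by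
  simp [ell, inversionsGe]

lemma ell_one : ell (1 : Equiv.Perm (Fin N)) = 0 := by
  rw [ell, Finset.card_eq_zero, Finset.filter_eq_empty_iff]
  rintro p - ⟨h₁, h₂⟩
  exact lt_asymm h₁ h₂

lemma ell_inv (v : Equiv.Perm (Fin N)) : ell v⁻¹ = ell v := by
  unfold ell
  refine Finset.card_bij' (fun p _ => (v⁻¹ p.2, v⁻¹ p.1)) (fun p _ => (v p.2, v p.1)) ?_ ?_ ?_ ?_
  all_goals simp +contextual

lemma adjSwap_of_lt {e : ℕ} (h : e + 1 < N) :
    adjSwap N e = Equiv.swap ⟨e, by omega⟩ ⟨e + 1, h⟩ := dif_pos h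

lemma adjSwap_apply_left {e : ℕ} (h : e + 1 < N) :
    adjSwap N e ⟨e, by omega⟩ = ⟨e + 1, h⟩ := by
  rw [adjSwap_of_lt h, Equiv.swap_apply_left]

lemma adjSwap_apply_right {e : ℕ} (h : e + 1 < N) :
    adjSwap N e ⟨e + 1, h⟩ = ⟨e, by omega⟩ := by
  rw [adjSwap_of_lt h, Equiv.swap_apply_right]

lemma adjSwap_apply_of_ne {e : ℕ} {p : Fin N} (h₁ : (p : ℕ) ≠ e) (h₂ : (p : ℕ) ≠ e + 1) :
    adjSwap N e p = p := by
  unfold adjSwap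
  split_ifs with h
  · exact Equiv.swap_apply_of_ne_of_ne (by simpa [Fin.ext_iff] using h₁)
      (by simpa [Fin.ext_iff] using h₂)
  · rfl

lemma adjSwap_mul_self (e : ℕ) : adjSwap N e * adjSwap N e = 1 := by
  unfold adjSwap
  split_ifs <;> simp

lemma adjSwap_adjSwap (e : ℕ) (p : Fin N) : adjSwap N e (adjSwap N e p) = p :=
  DFunLike.congr_fun (adjSwap_mul_self e) p

lemma adjSwap_inv (e : ℕ) : (adjSwap N e)⁻¹ = adjSwap N e :=
  inv_eq_of_mul_eq_one_left (adjSwap_mul_self e)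

lemma adjSwap_lt_adjSwap {e : ℕ} {p q : Fin N} (hpq : p < q)
    (hne : ¬((p : ℕ) = e ∧ (q : ℕ) = e + 1)) : adjSwap N e p < adjSwap N e q := by
  unfold adjSwap
  split_ifs with h
  · rw [Fin.lt_def] at *
    simp only [Equiv.swap_apply_def, Fin.ext_iff]
    grind
  · exact hpq

lemma card_inversionsGe_mul_adjSwap (m : ℕ) (v : Equiv.Perm (Fin N)) {e : ℕ} (h : e + 1 < N)
    (hv : v ⟨e, by omega⟩ < v ⟨e + 1, h⟩) :
    (inversionsGe m (v * adjSwap N e)).card =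
      (inversionsGe m v).card + if m ≤ (v ⟨e, by omega⟩ : ℕ) then 1 else 0 := by
  have key : ((inversionsGe m (v * adjSwap N e)).erase (⟨e, by omega⟩, ⟨e + 1, h⟩)).card =
      (inversionsGe m v).card := by
    refine Finset.card_bij' (fun p _ => (adjSwap N e p.1, adjSwap N e p.2))
      (fun p _ => (adjSwap N e p.1, adjSwap N e p.2)) ?_ ?_ ?_ ?_
    · rintro ⟨p, q⟩ hp
      simp only [Finset.mem_erase, mem_inversionsGe, Equiv.Perm.mul_apply, ne_eq, Prod.mk.injEq,
        Fin.ext_iff] at hp ⊢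
      exact ⟨adjSwap_lt_adjSwap hp.2.1 hp.1, hp.2.2⟩
    · rintro ⟨p, q⟩ hp
      simp only [Finset.mem_erase, mem_inversionsGe, Equiv.Perm.mul_apply, ne_eq, Prod.mk.injEq,
        adjSwap_adjSwap] at hp ⊢
      refine ⟨?_, adjSwap_lt_adjSwap hp.1 ?_, hp.2⟩
      · rintro ⟨h₁, h₂⟩
        have h₁' := congrArg (adjSwap N e) h₁
        have h₂' := congrArg (adjSwap N e) h₂
        rw [adjSwap_adjSwap, adjSwap_apply_left h] at h₁'
        rw [adjSwap_adjSwap, adjSwap_apply_right h] at h₂'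
        have := hp.1
        simp [h₁', h₂', Fin.lt_def] at this
      · rintro ⟨h₁, h₂⟩
        obtain rfl : p = ⟨e, Nat.lt_of_succ_lt h⟩ := Fin.ext h₁
        obtain rfl : q = ⟨e + 1, h⟩ := Fin.ext h₂
        exact lt_asymm hv hp.2.1
    · simp [adjSwap_adjSwap]
    · simp [adjSwap_adjSwap]
  have hmem : ((⟨e, by omega⟩, ⟨e + 1, h⟩) : Fin N × Fin N) ∈ inversionsGe m (v * adjSwap N e) ↔
      m ≤ (v ⟨e, by omega⟩ : ℕ) := by
    simp [mem_inversionsGe, Equiv.Perm.mul_apply, adjSwap_apply_left h, adjSwap_apply_right h, hv,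
      Fin.lt_def]
  split_ifs with hm
  · rw [← key, Finset.card_erase_add_one (hmem.2 hm)]
  · rw [← key, Finset.erase_eq_of_notMem (mt hmem.1 hm), add_zero]

lemma ell_mul_adjSwap_of_lt (v : Equiv.Perm (Fin N)) {e : ℕ} (h : e + 1 < N)
    (hv : v ⟨e, by omega⟩ < v ⟨e + 1, h⟩) : ell (v * adjSwap N e) = ell v + 1 := by
  simp [ell_eq_card_inversionsGe, card_inversionsGe_mul_adjSwap 0 v h hv]

lemma ell_mul_adjSwap_of_gt (v : Equiv.Perm (Fin N)) {e : ℕ} (h : e + 1 < N)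
    (hv : v ⟨e + 1, h⟩ < v ⟨e, by omega⟩) : ell (v * adjSwap N e) + 1 = ell v := by
  rw [← ell_mul_adjSwap_of_lt (v * adjSwap N e) h, mul_assoc, adjSwap_mul_self, mul_one]
  simpa [Equiv.Perm.mul_apply, adjSwap_apply_left h, adjSwap_apply_right h] using hv

lemma lt_or_gt_adjacent (v : Equiv.Perm (Fin N)) {e : ℕ} (h : e + 1 < N) :
    v ⟨e, by omega⟩ < v ⟨e + 1, h⟩ ∨ v ⟨e + 1, h⟩ < v ⟨e, by omega⟩ :=
  lt_or_gt_of_ne fun h' => by simpa using v.injective h'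

lemma ell_mul_adjSwap_le (v : Equiv.Perm (Fin N)) {e : ℕ} (h : e + 1 < N) :
    ell (v * adjSwap N e) ≤ ell v + 1 := by
  rcases lt_or_gt_adjacent v h with hv | hv
  · exact (ell_mul_adjSwap_of_lt v h hv).le
  · have := ell_mul_adjSwap_of_gt v h hv
    omega

lemma lt_of_ell_lt_ell_mul_adjSwap (v : Equiv.Perm (Fin N)) {e : ℕ} (h : e + 1 < N)
    (hv : ell v < ell (v * adjSwap N e)) : v ⟨e, by omega⟩ < v ⟨e + 1, h⟩ := by
  refine (lt_or_gt_adjacent v h).resolve_right fun hgt => ?_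
  have := ell_mul_adjSwap_of_gt v h hgt
  omega

lemma ell_prod_adjSwap_le (L : List ℕ) (hL : ∀ e ∈ L, e + 1 < N) :
    ell (L.map (adjSwap N)).prod ≤ L.length := by
  induction L using List.reverseRecOn with
  | nil => simp [ell_one]
  | append_singleton L e ih =>
    simp only [List.map_append, List.prod_append, List.map_singleton, List.prod_singleton,
      List.length_append, List.length_singleton]
    have h₁ := ih fun e he => hL e (by simp [he])
    have h₂ := ell_mul_adjSwap_le (L.map (adjSwap N)).prod (hL e (by simp))
    omega

lemma lt_of_forall_adjacent_lt {α : Type*} [Preorder α] (m : ℕ) (f : Fin N → α)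
    (hf : ∀ e, m ≤ e → ∀ h : e + 1 < N, f ⟨e, by omega⟩ < f ⟨e + 1, h⟩)
    {a b : Fin N} (ha : m ≤ (a : ℕ)) (hab : a < b) : f a < f b := by
  obtain ⟨b, hb⟩ := b
  induction b with
  | zero => exact absurd hab (by simp [Fin.lt_def])
  | succ b ih =>
    have hab' : (a : ℕ) ≤ b := Nat.lt_succ_iff.1 hab
    have hlast := hf b (ha.trans hab') hb
    rcases hab'.lt_or_eq with hlt | heq
    · exact lt_trans (ih (Nat.lt_of_succ_lt hb) hlt) hlast
    · rwa [show a = ⟨b, by omega⟩ from Fin.ext heq]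

/-- A permutation of minimal length in its right coset of the pointwise stabilizer of the values
below `m` has no inversion between values at least `m`. -/
lemma inv_lt_inv_of_minimal (m : ℕ) (v : Equiv.Perm (Fin N))
    (hmin : ∀ σ : Equiv.Perm (Fin N), (∀ p : Fin N, (p : ℕ) < m → σ p = p) → ell v ≤ ell (σ * v))
    {a b : Fin N} (ha : m ≤ (a : ℕ)) (hab : a < b) : v⁻¹ a < v⁻¹ b := by
  refine lt_of_forall_adjacent_lt m (v⁻¹ : Equiv.Perm (Fin N)) (fun e he h => ?_) ha hab
  refine (lt_or_gt_adjacent v⁻¹ h).resolve_right fun hgt => ?_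
  have h₁ := ell_mul_adjSwap_of_gt v⁻¹ h hgt
  have h₂ := hmin (adjSwap N e) fun p hp => adjSwap_apply_of_ne (by omega) (by omega)
  rw [← ell_inv (adjSwap N e * v), mul_inv_rev, adjSwap_inv, ← ell_inv v] at h₂
  omega

lemma le_apply_of_fixes_lt {m : ℕ} {σ : Equiv.Perm (Fin N)}
    (hσ : ∀ p : Fin N, (p : ℕ) < m → σ p = p) {p : Fin N} (hp : m ≤ (p : ℕ)) :
    m ≤ (σ p : ℕ) := by
  by_contra! h
  have := σ.injective (hσ _ h)
  omega

lemma card_inversionsGe_mul_of_minimal (m : ℕ) (w₁ w₂ : Equiv.Perm (Fin N))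
    (hw₁ : ∀ p : Fin N, (p : ℕ) < m → w₁ p = p)
    (hmin : ∀ σ : Equiv.Perm (Fin N), (∀ p : Fin N, (p : ℕ) < m → σ p = p) →
      ell w₂ ≤ ell (σ * w₂)) :
    (inversionsGe m (w₁ * w₂)).card = ell w₁ := by
  have large : ∀ {a : Fin N}, m ≤ (w₁ a : ℕ) → m ≤ (a : ℕ) := by
    intro a ha
    by_contra! h
    rw [hw₁ a h] at ha
    omega
  refine Finset.card_bij' (fun p _ => (w₂ p.1, w₂ p.2)) (fun p _ => (w₂⁻¹ p.1, w₂⁻¹ p.2))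
    ?_ ?_ ?_ ?_
  · rintro ⟨p, q⟩ hp
    simp only [mem_inversionsGe, Equiv.Perm.mul_apply, Finset.mem_filter, Finset.mem_univ,
      true_and] at hp ⊢
    refine ⟨?_, hp.2.1⟩
    by_contra! hle
    rcases hle.lt_or_eq with hlt | heq
    · have := inv_lt_inv_of_minimal m w₂ hmin (large hp.2.2) hlt
      simp only [Equiv.Perm.inv_def, Equiv.symm_apply_apply] at this
      exact lt_asymm this hp.1
    · exact hp.1.ne' (w₂.injective heq)
  · rintro ⟨a, b⟩ hp
    simp only [mem_inversionsGe, Equiv.Perm.mul_apply, Finset.mem_filter, Finset.mem_univ,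
      true_and, Equiv.Perm.inv_def, Equiv.apply_symm_apply] at hp ⊢
    have ha : m ≤ (a : ℕ) := by
      by_contra! ha
      have hlt := hp.2
      rw [hw₁ a ha] at hlt
      have hb : (w₁ b : ℕ) < m := lt_trans hlt ha
      have := w₁.injective (hw₁ _ hb)
      rw [this] at hlt
      exact lt_asymm hp.1 hlt
    exact ⟨inv_lt_inv_of_minimal m w₂ hmin ha hp.1, hp.2,
      le_apply_of_fixes_lt hw₁ (ha.trans (Fin.le_def.1 hp.1.le))⟩
  · simp
  · simp

end Length

section Action

variable {n : ℕ}

lemma eq_comp_adjSwap_iff (μ κ : Lab n) {e : ℕ} (h : e + 1 < 2 * n) :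
    κ = μ ∘ adjSwap (2 * n) e ↔
      (∀ j : Fin (2 * n), (j : ℕ) ≠ e → (j : ℕ) ≠ e + 1 → κ j = μ j) ∧
        κ ⟨e, by omega⟩ = μ ⟨e + 1, h⟩ ∧ κ ⟨e + 1, h⟩ = μ ⟨e, by omega⟩ := by
  constructor
  · rintro rfl
    refine ⟨fun j h₁ h₂ => ?_, ?_, ?_⟩
    · simp [adjSwap_apply_of_ne h₁ h₂]
    · simp [adjSwap_apply_left h]
    · simp [adjSwap_apply_right h]
  · rintro ⟨h₁, h₂, h₃⟩
    ext1 j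
    by_cases hj : (j : ℕ) = e
    · obtain rfl : j = ⟨e, Nat.lt_of_succ_lt h⟩ := Fin.ext hj
      simp [adjSwap_apply_left h, h₂]
    by_cases hj' : (j : ℕ) = e + 1
    · obtain rfl : j = ⟨e + 1, h⟩ := Fin.ext hj'
      simp [adjSwap_apply_right h, h₃]
    · simp [adjSwap_apply_of_ne hj hj', h₁ j hj hj']

lemma Tmat_row_of_le (μ κ : Lab n) {e : ℕ} (h : e + 1 < 2 * n)
    (hμ : μ ⟨e, by omega⟩ ≤ μ ⟨e + 1, h⟩) :
    Tmat n e μ κ = tt * if κ = μ ∘ adjSwap (2 * n) e then 1 else 0 := by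
  simp only [eq_comp_adjSwap_iff μ κ h, Tmat, Matrix.of_apply, dif_pos h, Tcoeff]
  grind

lemma Tmat_col_of_le (μ κ : Lab n) {e : ℕ} (h : e + 1 < 2 * n)
    (hμ : μ ⟨e, by omega⟩ ≤ μ ⟨e + 1, h⟩) :
    Tmat n e κ μ = (if μ ⟨e, by omega⟩ = μ ⟨e + 1, h⟩ then tt else 1) *
      if κ = μ ∘ adjSwap (2 * n) e then 1 else 0 := by
  simp only [eq_comp_adjSwap_iff μ κ h, Tmat, Matrix.of_apply, dif_pos h, Tcoeff]
  grind

lemma labP2_mul (v s : Equiv.Perm (Fin (2 * n))) : labP2 n (v * s) = labP2 n v ∘ s := rfl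

lemma labP2_le_labP2 (v : Equiv.Perm (Fin (2 * n))) {p q : Fin (2 * n)} (hv : v p < v q) :
    labP2 n v p ≤ labP2 n v q := by
  unfold labP2
  rw [Fin.lt_def] at hv
  rw [Fin.le_def]
  split_ifs <;> simp only [Fin.val_last] <;> omega

lemma labP2_eq_labP2_iff (v : Equiv.Perm (Fin (2 * n))) {p q : Fin (2 * n)} (hv : v p < v q) :
    labP2 n v p = labP2 n v q ↔ n ≤ (v p : ℕ) := by
  unfold labP2
  rw [Fin.lt_def] at hv
  rw [Fin.ext_iff]
  split_ifs <;> simp only [Fin.val_last, true_iff] <;> omega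

lemma labP2_mul_left (w₁ w₂ : Equiv.Perm (Fin (2 * n)))
    (hw₁ : ∀ p : Fin (2 * n), (p : ℕ) < n → w₁ p = p) : labP2 n (w₁ * w₂) = labP2 n w₂ := by
  ext1 p
  by_cases h : (w₂ p : ℕ) < n
  · simp [labP2, Equiv.Perm.mul_apply, hw₁ _ h]
  · have := le_apply_of_fixes_lt hw₁ (not_lt.1 h)
    simp [labP2, Equiv.Perm.mul_apply, h, this.not_gt]

lemma prod_Tmat_row (L : List ℕ) (hL : ∀ e ∈ L, e + 1 < 2 * n)
    (hred : L.length = ell (L.map (adjSwap (2 * n))).prod) (κ : Lab n) :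
    (L.map (Tmat n)).prod (labP2 n 1) κ =
      tt ^ L.length * if κ = labP2 n (L.map (adjSwap (2 * n))).prod then 1 else 0 := by
  induction L using List.reverseRecOn generalizing κ with
  | nil => simp [Matrix.one_apply, eq_comm]
  | append_singleton L e ih =>
    have he := hL e (by simp)
    have hL' : ∀ e ∈ L, e + 1 < 2 * n := fun e he => hL e (by simp [he])
    simp only [List.map_append, List.prod_append, List.map_singleton, List.prod_singleton,
      List.length_append, List.length_singleton] at hred ⊢
    have h₁ := ell_prod_adjSwap_le L hL'
    have h₂ := ell_mul_adjSwap_le (L.map (adjSwap (2 * n))).prod he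
    have hlt := lt_of_ell_lt_ell_mul_adjSwap (L.map (adjSwap (2 * n))).prod he (by omega)
    rw [Matrix.mul_apply]
    simp only [ih hL' (by omega), mul_ite, mul_one, mul_zero, ite_mul, zero_mul,
      Finset.sum_ite_eq', Finset.mem_univ, if_true]
    rw [Tmat_row_of_le _ _ he (labP2_le_labP2 _ hlt), labP2_mul]
    split_ifs <;> ring

lemma prod_Tmat_col (L : List ℕ) (hL : ∀ e ∈ L, e + 1 < 2 * n)
    (hred : L.length = ell (L.map (adjSwap (2 * n))).prod) (κ : Lab n) :
    (L.map (Tmat n)).prod κ (labP2 n 1) =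
      tt ^ (inversionsGe n (L.map (adjSwap (2 * n))).prod⁻¹).card *
        if κ = labP2 n (L.map (adjSwap (2 * n))).prod⁻¹ then 1 else 0 := by
  induction L generalizing κ with
  | nil =>
    have : (inversionsGe n (1 : Equiv.Perm (Fin (2 * n)))).card = 0 := by
      rw [Finset.card_eq_zero, Finset.eq_empty_iff_forall_notMem]
      intro p hp
      rw [mem_inversionsGe] at hp
      exact lt_asymm hp.1 hp.2.1
    simp [Matrix.one_apply, this]
  | cons e L ih =>
    have he := hL e (by simp)
    have hL' : ∀ e ∈ L, e + 1 < 2 * n := fun e he => hL e (by simp [he])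
    simp only [List.map_cons, List.prod_cons, List.length_cons, mul_inv_rev, adjSwap_inv]
      at hred ⊢
    rw [← ell_inv, mul_inv_rev, adjSwap_inv] at hred
    have h₁ := ell_prod_adjSwap_le L hL'
    rw [← ell_inv] at h₁
    have h₂ := ell_mul_adjSwap_le (L.map (adjSwap (2 * n))).prod⁻¹ he
    have hlt := lt_of_ell_lt_ell_mul_adjSwap (L.map (adjSwap (2 * n))).prod⁻¹ he (by omega)
    rw [Matrix.mul_apply]
    simp only [ih hL' (by rw [← ell_inv]; omega), mul_ite, mul_one, mul_zero,
      Finset.sum_ite_eq', Finset.mem_univ, if_true]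
    rw [Tmat_col_of_le _ _ he (labP2_le_labP2 _ hlt), labP2_mul,
      card_inversionsGe_mul_adjSwap n _ he hlt]
    simp only [labP2_eq_labP2_iff _ hlt]
    split_ifs <;> ring

end Action

/-- for `w ∈ S_{2n}` with reduced word `L` and `T_w` the corresponding product of the `T_i`:
(a) `⟨1| ∘ T_w = t^{ℓ(w)}·⟨w|`; (b) if `w⁻¹ = w₁·w₂` with `w₁` fixing `1,…,n` pointwise and
`w₂` minimal in its coset `S⁽²⁾·w⁻¹`, then `T_w |1⟩ = t^{ℓ(w₁)}·|w₂⟩`. -/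
theorem statement14 (n : ℕ) (w : Equiv.Perm (Fin (2 * n))) (L : List ℕ)
    (hL : ∀ e ∈ L, e + 1 < 2 * n)
    (hw : w = (L.map fun e =>
        if h : e + 1 < 2 * n then Equiv.swap (⟨e, by omega⟩ : Fin (2 * n)) ⟨e + 1, h⟩
        else 1).prod)
    (hred : L.length = ell w) :
    (∀ κ : Lab n,
        ((L.map fun e => Tmat n e).prod) (labP2 n 1) κ =
          tt ^ ell w * if κ = labP2 n w then 1 else 0) ∧
      ∀ w₁ w₂ : Equiv.Perm (Fin (2 * n)),
        (∀ p : Fin (2 * n), (p : ℕ) < n → w₁ p = p) →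
        w⁻¹ = w₁ * w₂ →
        (∀ σ : Equiv.Perm (Fin (2 * n)),
          (∀ p : Fin (2 * n), (p : ℕ) < n → σ p = p) → ell w₂ ≤ ell (σ * w₂)) →
        ∀ κ : Lab n,
          ((L.map fun e => Tmat n e).prod) κ (labP2 n 1) =
            tt ^ ell w₁ * if κ = labP2 n w₂ then 1 else 0 := by
  change w = (L.map (adjSwap (2 * n))).prod at hw
  subst hw
  refine ⟨fun κ => ?_, fun w₁ w₂ hw₁ hfac hmin κ => ?_⟩
  · rw [← hred]
    exact prod_Tmat_row L hL hred κ
  · refine (prod_Tmat_col L hL hred κ).trans ?_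
    rw [hfac, card_inversionsGe_mul_of_minimal n w₁ w₂ hw₁ hmin, labP2_mul_left w₁ w₂ hw₁]
end
end
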